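/- For every integer k > 0, the set MF(C^k) of minimal forbidden words of C^k equals the set of words of MF(C^∞) whose height is less than or equal to k. -/

import Mathlib

/- Common framework: words over the alphabet Σ = {1,2} (represented as natural
numbers), run-length encoding, the derivative D, k-differentiable words C^k,
C∞-words, heights, roots, primitives, minimal/maximal words, simple extensions,
minimal forbidden words, and the left frontier Ψ. -/

namespace CinftyWords

/-- A word is a finite sequence of natural numbers. -/
abbrev Word := List ℕ

/-- `w` is a word over the alphabet Σ = {1,2}. -/
def IsWord (w : Word) : Prop := ∀ x ∈ w, x = 1 ∨ x = 2

/-- Complement of a letter: exchanges 1 and 2. -/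
def bar (x : ℕ) : ℕ := 3 - x

/-- Letterwise complement of a word. -/
def comp (w : Word) : Word := w.map bar

/-- Run-length encoding Δ: the sequence of lengths of maximal runs of equal
consecutive letters. -/
def rle (w : Word) : Word := (w.splitBy (· == ·)).map List.length

/-- Drop the first run if it has length 1. -/
def dropFirstRun1 (g : List (List ℕ)) : List (List ℕ) :=
  match g with
  | [] => []
  | r :: rs => if r.length = 1 then rs else r :: rs

/-- The derivative `D w`: the run-length encoding of the word obtained from `w`
by deleting its first and/or last run when that run has length 1. -/
def D (w : Word) : Word :=
  ((dropFirstRun1 ((dropFirstRun1 (w.splitBy (· == ·))).reverse)).reverse).map List.length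

/-- `w` is differentiable: `w` is a word over Σ and so is its run-length encoding. -/
def Diffble (w : Word) : Prop := IsWord w ∧ IsWord (rle w)

/-- The set C^k of k-differentiable words: `D^[j] w` is differentiable for all `j < k`
(so that `D^[k] w` is defined). -/
def CK (k : ℕ) : Set Word := {w | IsWord w ∧ ∀ j < k, Diffble (D^[j] w)}

/-- The set C∞ of words differentiable arbitrarily many times. -/
def Cinf : Set Word := {w | ∀ k : ℕ, w ∈ CK k}

/-- The height of a C∞-word: the least `k` with `D^[k] w = []`. -/
noncomputable def height (w : Word) : ℕ := sInf {k | D^[k] w = []}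

/-- The root of a C∞-word: `D^[height w - 1] w`. -/
noncomputable def root (w : Word) : Word := D^[height w - 1] w

/-- `v` is a primitive of `w`: `v` is differentiable and `D v = w`. -/
def IsPrimitive (v w : Word) : Prop := Diffble v ∧ D v = w

/-- A nonempty C∞-word is maximal if each `D^[j] w` (for `j ≤ height w - 2`) is a
primitive of `D^[j+1] w` of maximal length (vacuously true when `height w = 1`). -/
def MaximalWord (w : Word) : Prop :=
  w ∈ Cinf ∧ w ≠ [] ∧ ∀ j, j + 2 ≤ height w →
    ∀ v, IsPrimitive v (D^[j + 1] w) → v.length ≤ (D^[j] w).length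

/-- A nonempty C∞-word is minimal if each `D^[j] w` (for `j ≤ height w - 2`) is a
primitive of `D^[j+1] w` of minimal length (vacuously true when `height w = 1`). -/
def MinimalWord (w : Word) : Prop :=
  w ∈ Cinf ∧ w ≠ [] ∧ ∀ j, j + 2 ≤ height w →
    ∀ v, IsPrimitive v (D^[j + 1] w) → (D^[j] w).length ≤ v.length

/-- `w` is right maximal: a suffix of a maximal word. -/
def RightMaximal (w : Word) : Prop := ∃ v, MaximalWord v ∧ w <:+ v

/-- `w` is left maximal: a prefix of a maximal word. -/
def LeftMaximal (w : Word) : Prop := ∃ v, MaximalWord v ∧ w <+: v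

/-- `w` is right minimal: a suffix of a minimal word. -/
def RightMinimal (w : Word) : Prop := ∃ v, MinimalWord v ∧ w <:+ v

/-- `w` is left minimal: a prefix of a minimal word. -/
def LeftMinimal (w : Word) : Prop := ∃ v, MinimalWord v ∧ w <+: v

/-- `w` is right doubly extendable: both `w1` and `w2` are C∞-words. -/
def RightDoublyExt (w : Word) : Prop := w ++ [1] ∈ Cinf ∧ w ++ [2] ∈ Cinf

/-- `w` is left doubly extendable: both `1w` and `2w` are C∞-words. -/
def LeftDoublyExt (w : Word) : Prop := 1 :: w ∈ Cinf ∧ 2 :: w ∈ Cinf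

/-- `w` is fully extendable: `1w1`, `1w2`, `2w1`, `2w2` are all C∞-words. -/
def FullyExt (w : Word) : Prop :=
  ∀ x, (x = 1 ∨ x = 2) → ∀ y, (y = 1 ∨ y = 2) → x :: (w ++ [y]) ∈ Cinf

/-- `w'` is a right simple extension of `w`: `w' = w ++ s` is a C∞-word and at each
step the extension by the complementary letter is not a C∞-word. -/
def RightSimpleExt (w w' : Word) : Prop :=
  w' ∈ Cinf ∧ ∃ s : Word, IsWord s ∧ w' = w ++ s ∧
    ∀ i < s.length, w ++ s.take i ++ [bar (s.getD i 0)] ∉ Cinf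

/-- `w'` is a left simple extension of `w`. -/
def LeftSimpleExt (w w' : Word) : Prop := RightSimpleExt w.reverse w'.reverse

/-- `w'` is a simple extension of `w`: a right simple extension of a left simple
extension of `w`. -/
def SimpleExt (w w' : Word) : Prop := ∃ v, LeftSimpleExt w v ∧ RightSimpleExt v w'

/-- `m` is the maximal extension of `w`: a simple extension of `w` of maximal length. -/
def IsMaximalExtension (w m : Word) : Prop :=
  SimpleExt w m ∧ ∀ v, SimpleExt w v → v.length ≤ m.length

/-- A language is factorial if it is closed under taking factors. -/
def Factorial (F : Set Word) : Prop := ∀ v ∈ F, ∀ u, u <:+: v → u ∈ F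

/-- A language is anti-factorial if no word of it is a proper factor of another
word of it. -/
def AntiFactorial (M : Set Word) : Prop := ∀ u ∈ M, ∀ v ∈ M, u ≠ v → ¬ u <:+: v

/-- The set of minimal forbidden words of a (factorial) language `F`: words not
in `F` whose maximal proper prefix and maximal proper suffix are both in `F`. -/
def MF (F : Set Word) : Set Word := {v | v ∉ F ∧ v.dropLast ∈ F ∧ v.tail ∈ F}

/-- The height of a minimal forbidden word of C∞: `k + 1`, where `k` is the
(unique) integer such that `w` is k-differentiable and `D^[k] w ∈ {111, 222}`. -/
noncomputable def MFheight (w : Word) : ℕ :=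
  sInf {k | w ∈ CK k ∧ (D^[k] w = [1, 1, 1] ∨ D^[k] w = [2, 2, 2])} + 1

/-- The left frontier Ψ of a C∞-word: the word of length `height w` over {0,1,2}
recording the first letter of each derivative, with `2` replaced by `0` when the
first two letters of the previous derivative are distinct. -/
noncomputable def psi (w : Word) : List ℕ :=
  (List.range (height w)).map (fun i =>
    if i = 0 then w.getD 0 0
    else if (D^[i] w).getD 0 0 = 2 ∧ (D^[i - 1] w).getD 0 0 ≠ (D^[i - 1] w).getD 1 0 then 0
    else (D^[i] w).getD 0 0)

end CinftyWords

namespace CinftyWords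

/-- Delete the first letter of a word when it is equal to 1. -/
def trimHead : Word → Word
  | [] => []
  | x :: t => if x = 1 then t else x :: t

/-- Delete the last letter of a word when it is equal to 1. -/
def trimLast (w : Word) : Word := (trimHead w.reverse).reverse

lemma trimLast_cons_cons (x y : ℕ) (t : Word) :
    trimLast (x :: y :: t) = x :: trimLast (y :: t) := by
  obtain ⟨z, s, hz⟩ : ∃ z s, (y :: t).reverse = z :: s :=
    List.exists_cons_of_ne_nil (by simp)
  have hx : (x :: y :: t).reverse = z :: (s ++ [x]) := by
    rw [List.reverse_cons, hz, List.cons_append]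
  unfold trimLast
  rw [hx, hz]
  by_cases h : z = 1 <;> simp [trimHead, h]

lemma tail_trimLast_cons (x : ℕ) (t : Word) : (trimLast (x :: t)).tail = trimLast t := by
  cases t with
  | nil => by_cases hx : x = 1 <;> simp [trimLast, trimHead, hx]
  | cons y t => simp [trimLast_cons_cons]

lemma trimLast_trimHead (w : Word) : trimLast (trimHead w) = trimHead (trimLast w) := by
  match w with
  | [] => rfl
  | [x] => by_cases hx : x = 1 <;> simp [trimLast, trimHead, hx]
  | x :: y :: t => by_cases hx : x = 1 <;> simp [trimHead, hx, trimLast_cons_cons]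

lemma map_length_dropFirstRun1 (g : List (List ℕ)) :
    (dropFirstRun1 g).map List.length = trimHead (g.map List.length) := by
  cases g with
  | nil => rfl
  | cons r g => by_cases h : r.length = 1 <;> simp [dropFirstRun1, trimHead, h]

lemma D_eq_trim (w : Word) : D w = trimLast (trimHead (rle w)) := by
  simp [D, trimLast, rle, map_length_dropFirstRun1]

lemma splitBy_reverse (w : Word) :
    w.reverse.splitBy (· == ·) = ((w.splitBy (· == ·)).map List.reverse).reverse := by
  rw [List.splitBy_eq_iff]
  refine ⟨?_, by simp, ?_, ?_⟩
  · rw [← List.reverse_flatten, List.flatten_splitBy]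
  · intro m hm
    simp only [List.mem_reverse, List.mem_map] at hm
    obtain ⟨m, hm, rfl⟩ := hm
    rw [List.isChain_reverse]
    refine (List.isChain_of_mem_splitBy hm).imp fun a b h => ?_
    simpa using (beq_iff_eq.1 h).symm
  · rw [List.isChain_reverse, List.isChain_map]
    refine (List.isChain_getLast_head_splitBy _ w).imp fun a b h => ?_
    obtain ⟨ha, hb, h⟩ := h
    refine ⟨by simpa using hb, by simpa using ha, ?_⟩
    simpa using Ne.symm (beq_eq_false_iff_ne.1 h)

lemma rle_reverse (w : Word) : rle w.reverse = (rle w).reverse := by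
  simp [rle, splitBy_reverse, List.map_reverse, Function.comp_def]

lemma rle_cons_of_ne {a b : ℕ} (hab : a ≠ b) (l : Word) :
    rle (a :: b :: l) = 1 :: rle (b :: l) := by
  have h := List.splitBy_append_cons (r := fun x y : ℕ => x == y) (l := [a]) (a := b) l
    (by simpa using hab)
  have h₁ : [a].splitBy (fun x y : ℕ => x == y) = [[a]] := rfl
  rw [h₁] at h
  simp only [List.singleton_append] at h
  simp [rle, h]

lemma rle_cons_self (a : ℕ) (l : Word) :
    ∃ h t, 0 < h ∧ rle (a :: l) = h :: t ∧ rle (a :: a :: l) = (h + 1) :: t := by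
  obtain ⟨g, gs, hg⟩ : ∃ g gs, (a :: l).splitBy (fun x y : ℕ => x == y) = g :: gs :=
    List.exists_cons_of_ne_nil (by simp)
  obtain ⟨hf, hn, hc, hc'⟩ := List.splitBy_eq_iff.1 hg
  have hg0 : g ≠ [] := by rintro rfl; simp at hn
  obtain ⟨b, g, rfl⟩ := List.exists_cons_of_ne_nil hg0
  obtain rfl : a = b := by simpa using congrArg List.head? hf
  have hs : (a :: a :: l).splitBy (fun x y : ℕ => x == y) = (a :: a :: g) :: gs := by
    rw [List.splitBy_eq_iff]
    refine ⟨by simp [hf], by simpa using hn, ?_, ?_⟩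
    · intro m hm
      rcases List.mem_cons.1 hm with rfl | hm
      · exact List.isChain_cons_cons.2 ⟨by simp, hc _ (by simp)⟩
      · exact hc m (by simp [hm])
    · rw [List.isChain_cons] at hc' ⊢
      refine ⟨fun y hy => ?_, hc'.2⟩
      obtain ⟨h₁, h₂, h₃⟩ := hc'.1 y hy
      exact ⟨by simp, h₂, by simpa using h₃⟩
  exact ⟨g.length + 1, gs.map List.length, by simp, by simp [rle, hg], by simp [rle, hs]⟩

/-- Prepending a letter either creates a new run of length 1 or lengthens the first run. -/
lemma rle_cons (a : ℕ) (w : Word) :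
    rle (a :: w) = 1 :: rle w ∨
      ∃ h t, 0 < h ∧ rle w = h :: t ∧ rle (a :: w) = (h + 1) :: t := by
  cases w with
  | nil => exact Or.inl rfl
  | cons b l =>
    by_cases hab : a = b
    · subst hab
      exact Or.inr (rle_cons_self a l)
    · exact Or.inl (rle_cons_of_ne hab l)

@[simp] lemma isWord_cons {x : ℕ} {w : Word} :
    IsWord (x :: w) ↔ (x = 1 ∨ x = 2) ∧ IsWord w := by
  simp [IsWord]

lemma isWord_reverse {w : Word} : IsWord w.reverse ↔ IsWord w := by simp [IsWord]

lemma IsWord.of_sublist {v w : Word} (hw : IsWord w) (h : v.Sublist w) : IsWord v :=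
  fun x hx => hw x (h.subset hx)

lemma Diffble.reverse {w : Word} (h : Diffble w) : Diffble w.reverse :=
  ⟨isWord_reverse.2 h.1, by rw [rle_reverse]; exact isWord_reverse.2 h.2⟩

lemma trimHead_sublist (w : Word) : (trimHead w).Sublist w := by
  cases w with
  | nil => exact List.Sublist.refl _
  | cons x t => by_cases hx : x = 1 <;> simp [trimHead, hx]

lemma trimLast_sublist (w : Word) : (trimLast w).Sublist w := by
  simpa [trimLast] using (trimHead_sublist w.reverse).reverse

lemma Diffble.isWord_D {w : Word} (h : Diffble w) : IsWord (D w) := by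
  rw [D_eq_trim]
  exact h.2.of_sublist ((trimLast_sublist _).trans (trimHead_sublist _))

lemma D_reverse (w : Word) : D w.reverse = (D w).reverse := by
  rw [D_eq_trim, D_eq_trim, rle_reverse, trimLast_trimHead (rle w)]
  simp [trimLast]

lemma iterate_D_reverse (j : ℕ) (w : Word) : D^[j] w.reverse = (D^[j] w).reverse := by
  induction j generalizing w with
  | zero => rfl
  | succ j ih => rw [Function.iterate_succ_apply, Function.iterate_succ_apply, D_reverse, ih]

lemma Diffble.D_tail {w : Word} (h : Diffble w) :
    D w.tail = D w ∨ D w.tail = (D w).tail := by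
  cases w with
  | nil => exact Or.inl rfl
  | cons a w =>
    have hr := h.2
    simp only [D_eq_trim, List.tail_cons]
    rcases rle_cons a w with hc | ⟨m, t, hm, ht, hc⟩ <;> rw [hc] at hr ⊢
    · cases hw : rle w with
      | nil => simp [trimHead]
      | cons x t =>
        by_cases hx : x = 1
        · right
          simp [trimHead, hx, tail_trimLast_cons]
        · left
          simp [trimHead, hx]
    · right
      obtain rfl : m = 1 := by have := (isWord_cons.1 hr).1; omega
      simp [ht, trimHead, tail_trimLast_cons]

lemma CK_mono {i k : ℕ} (h : i ≤ k) {w : Word} (hw : w ∈ CK k) : w ∈ CK i :=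
  ⟨hw.1, fun j hj => hw.2 j (hj.trans_le h)⟩

lemma reverse_mem_CK {k : ℕ} {w : Word} (h : w ∈ CK k) : w.reverse ∈ CK k :=
  ⟨isWord_reverse.2 h.1, fun j hj => by
    rw [iterate_D_reverse]
    exact (h.2 j hj).reverse⟩

lemma reverse_tail_reverse (w : Word) : w.reverse.tail.reverse = w.dropLast := by
  simp

lemma iterate_D_tail {j : ℕ} {w : Word} (h : w ∈ CK j) :
    D^[j] w.tail = D^[j] w ∨ D^[j] w.tail = (D^[j] w).tail := by
  induction j with
  | zero => exact Or.inr rfl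
  | succ j ih =>
    have hd := h.2 j (Nat.lt_succ_self j)
    simp only [Function.iterate_succ_apply']
    rcases ih (CK_mono (Nat.le_succ j) h) with ih | ih <;> rw [ih]
    · exact Or.inl rfl
    · exact hd.D_tail

lemma iterate_D_dropLast {j : ℕ} {w : Word} (h : w ∈ CK j) :
    D^[j] w.dropLast = D^[j] w ∨ D^[j] w.dropLast = (D^[j] w).dropLast := by
  rw [← reverse_tail_reverse w, ← reverse_tail_reverse (D^[j] w), iterate_D_reverse]
  rcases iterate_D_tail (reverse_mem_CK h) with h | h <;> rw [h, iterate_D_reverse]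
  · left; simp
  · right; rfl

lemma not_isWord_rle_cube (a : ℕ) (l : Word) : ¬ IsWord (rle (a :: a :: a :: l)) := by
  obtain ⟨m, t, hm, h₁, h₂⟩ := rle_cons_self a l
  obtain ⟨m', t', -, h₃, h₄⟩ := rle_cons_self a (a :: l)
  rw [h₂, List.cons.injEq] at h₃
  rw [h₄, isWord_cons]
  omega

lemma not_diffble_cube (x : ℕ) : ¬ Diffble [x, x, x] :=
  fun h => not_isWord_rle_cube x [] h.2

/-- The minimal forbidden words of the differentiable words over {1,2} are the cubes of
letters. -/
lemma eq_cube_of_not_diffble {u : Word} (hu : IsWord u) (hn : ¬ Diffble u)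
    (ht : Diffble u.tail) (hd : Diffble u.dropLast) :
    ∃ x, (x = 1 ∨ x = 2) ∧ u = [x, x, x] := by
  match u, hu, hn, ht, hd with
  | [], hu, hn, ht, _ => exact absurd ht hn
  | [a], hu, hn, _, _ =>
    refine absurd ⟨hu, ?_⟩ hn
    change IsWord [1]
    simp [IsWord]
  | a :: b :: w, hu, hn, ht, hd =>
    have hr : ¬ IsWord (rle (a :: b :: w)) := fun h => hn ⟨hu, h⟩
    have hr' : IsWord (rle (b :: w)) := ht.2
    obtain rfl : a = b := by
      by_contra hab
      exact hr (by simpa [rle_cons_of_ne hab] using hr')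
    cases w with
    | nil =>
      refine absurd ?_ hr
      have : rle [a, a] = [2] := by
        obtain ⟨m, t, -, h₁, h₂⟩ := rle_cons_self a []
        obtain ⟨rfl, rfl⟩ : 1 = m ∧ [] = t := by simpa using (show [1] = m :: t from h₁)
        exact h₂
      simp [this, IsWord]
    | cons c w =>
      obtain rfl : a = c := by
        by_contra hac
        refine hr ?_
        obtain ⟨m, t, -, h₁, h₂⟩ := rle_cons_self a (c :: w)
        rw [rle_cons_of_ne hac, List.cons.injEq] at h₁
        obtain ⟨rfl, rfl⟩ := h₁
        rw [rle_cons_of_ne hac] at hr'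
        rw [h₂]
        simpa using (isWord_cons.1 hr').2
      cases w with
      | nil => exact ⟨a, (isWord_cons.1 hu).1, rfl⟩
      | cons d w => exact absurd hd.2 (not_isWord_rle_cube a _)

lemma exists_not_diffble {k : ℕ} {w : Word} (hw : IsWord w) (hn : w ∉ CK k) :
    ∃ j < k, w ∈ CK j ∧ IsWord (D^[j] w) ∧ ¬ Diffble (D^[j] w) := by
  have hex : ∃ j, j < k ∧ ¬ Diffble (D^[j] w) := by
    by_contra! h
    exact hn ⟨hw, h⟩
  classical
  obtain ⟨hlt, hnd⟩ := Nat.find_spec hex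
  have hmin : ∀ i < Nat.find hex, Diffble (D^[i] w) := fun i hi => by
    by_contra h
    exact Nat.find_min hex hi ⟨hi.trans hlt, h⟩
  refine ⟨Nat.find hex, hlt, ⟨hw, hmin⟩, ?_, hnd⟩
  cases hj : Nat.find hex with
  | zero => exact hw
  | succ i =>
    rw [Function.iterate_succ_apply']
    exact (hmin i (by omega)).isWord_D

/-- Iterating the derivative on a minimal forbidden word of `C^k` over {1,2} reaches the cube
of a letter in fewer than `k` steps. -/
lemma exists_iterate_D_eq_cube {k : ℕ} {w : Word} (hw : IsWord w) (h : w ∈ MF (CK k)) :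
    ∃ j < k, w ∈ CK j ∧ ∃ x, (x = 1 ∨ x = 2) ∧ D^[j] w = [x, x, x] ∧
      D^[j] w.tail = [x, x] ∧ D^[j] w.dropLast = [x, x] := by
  obtain ⟨hn, hd, ht⟩ := h
  obtain ⟨j, hj, hwj, hu, hnd⟩ := exists_not_diffble hw hn
  have hdj := hd.2 j hj
  have htj := ht.2 j hj
  have ht' : D^[j] w.tail = (D^[j] w).tail :=
    (iterate_D_tail hwj).resolve_left fun h => hnd (h ▸ htj)
  have hd' : D^[j] w.dropLast = (D^[j] w).dropLast :=
    (iterate_D_dropLast hwj).resolve_left fun h => hnd (h ▸ hdj)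
  obtain ⟨x, hx, hc⟩ := eq_cube_of_not_diffble hu hnd (ht' ▸ htj) (hd' ▸ hdj)
  exact ⟨j, hj, hwj, x, hx, hc, by simp [ht', hc], by simp [hd', hc]⟩

lemma mem_Cinf_iff {w : Word} : w ∈ Cinf ↔ IsWord w ∧ ∀ j, Diffble (D^[j] w) :=
  ⟨fun h => ⟨(h 0).1, fun j => (h (j + 1)).2 j (Nat.lt_succ_self j)⟩,
    fun h _ => ⟨h.1, fun j _ => h.2 j⟩⟩

lemma nil_mem_Cinf : ([] : Word) ∈ Cinf := by
  have hD : ∀ j, D^[j] ([] : Word) = [] := fun j => Function.iterate_fixed rfl j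
  rw [mem_Cinf_iff]
  exact ⟨by simp [IsWord], fun j => by rw [hD]; simp [Diffble, IsWord, rle]⟩

lemma mem_Cinf_of_iterate {j : ℕ} {w : Word} (hw : w ∈ CK j) (h : D^[j] w ∈ Cinf) :
    w ∈ Cinf := by
  rw [mem_Cinf_iff] at h ⊢
  refine ⟨hw.1, fun i => ?_⟩
  rcases lt_or_ge i j with hi | hi
  · exact hw.2 i hi
  · have := h.2 (i - j)
    rwa [← Function.iterate_add_apply, Nat.sub_add_cancel hi] at this

lemma square_mem_Cinf {x : ℕ} (hx : x = 1 ∨ x = 2) : [x, x] ∈ Cinf := by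
  have h : D^[2] [x, x] = [] ∧ Diffble [x, x] ∧ Diffble (D [x, x]) := by
    rcases hx with rfl | rfl <;>
      simp [Diffble, IsWord, D, rle, dropFirstRun1, List.splitBy, List.splitBy.loop]
  refine mem_Cinf_of_iterate (j := 2) ⟨h.2.1.1, fun j hj => ?_⟩ (by rw [h.1]; exact nil_mem_Cinf)
  interval_cases j
  · exact h.2.1
  · exact h.2.2

lemma tail_eq_nil_of_not_isWord {w : Word} (hw : ¬ IsWord w) (ht : IsWord w.tail)
    (hd : IsWord w.dropLast) : w.tail = [] ∧ w.dropLast = [] := by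
  match w, hw, ht, hd with
  | [], hw, ht, _ => exact absurd ht hw
  | [a], _, _, _ => simp
  | a :: b :: w, hw, ht, hd =>
    rw [List.dropLast_cons_cons, isWord_cons] at hd
    exact absurd (isWord_cons.2 ⟨hd.1, ht⟩) hw

lemma MFheight_le {j : ℕ} {w : Word} {x : ℕ} (hx : x = 1 ∨ x = 2) (hw : w ∈ CK j)
    (h : D^[j] w = [x, x, x]) : MFheight w ≤ j + 1 := by
  refine Nat.succ_le_succ (Nat.sInf_le ⟨hw, ?_⟩)
  rcases hx with rfl | rfl <;> simp [h]

lemma MFheight_of_not_isWord {w : Word} (hw : ¬ IsWord w) : MFheight w = 1 := by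
  have : {k | w ∈ CK k ∧ (D^[k] w = [1, 1, 1] ∨ D^[k] w = [2, 2, 2])} = ∅ :=
    Set.eq_empty_of_forall_notMem fun k hk => hw hk.1.1
  simp [MFheight, this]

lemma exists_iterate_D_MFheight {w : Word} (hw : IsWord w) (h : w ∈ MF Cinf) :
    ∃ j x, MFheight w = j + 1 ∧ D^[j] w = [x, x, x] := by
  obtain ⟨hn, hd, ht⟩ := h
  obtain ⟨n, hn⟩ : ∃ n, w ∉ CK n := by simpa [Cinf] using hn
  obtain ⟨j, -, hwj, x, hx, hc, -⟩ := exists_iterate_D_eq_cube hw ⟨hn, hd n, ht n⟩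
  have hne : {k | w ∈ CK k ∧ (D^[k] w = [1, 1, 1] ∨ D^[k] w = [2, 2, 2])}.Nonempty :=
    ⟨j, hwj, by rcases hx with rfl | rfl <;> simp [hc]⟩
  rcases (Nat.sInf_mem hne).2 with h | h
  · exact ⟨_, 1, rfl, h⟩
  · exact ⟨_, 2, rfl, h⟩

lemma mem_MF_Cinf_of_mem_MF_CK {k : ℕ} (hk : 0 < k) {w : Word} (h : w ∈ MF (CK k)) :
    w ∈ MF Cinf ∧ MFheight w ≤ k := by
  have hn : w ∉ Cinf := fun hw => h.1 (hw k)
  by_cases hw : IsWord w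
  · obtain ⟨j, hj, hwj, x, hx, hc, ht, hd⟩ := exists_iterate_D_eq_cube hw h
    refine ⟨⟨hn, ?_, ?_⟩, (MFheight_le hx hwj hc).trans hj⟩
    · exact mem_Cinf_of_iterate (CK_mono hj.le h.2.1) (hd ▸ square_mem_Cinf hx)
    · exact mem_Cinf_of_iterate (CK_mono hj.le h.2.2) (ht ▸ square_mem_Cinf hx)
  · obtain ⟨ht, hd⟩ := tail_eq_nil_of_not_isWord hw h.2.2.1 h.2.1.1
    exact ⟨⟨hn, hd ▸ nil_mem_Cinf, ht ▸ nil_mem_Cinf⟩, (MFheight_of_not_isWord hw).trans_le hk⟩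

lemma mem_MF_CK_of_mem_MF_Cinf {k : ℕ} {w : Word} (h : w ∈ MF Cinf) (hk : MFheight w ≤ k) :
    w ∈ MF (CK k) := by
  refine ⟨fun hwk => ?_, h.2.1 k, h.2.2 k⟩
  obtain ⟨j, x, hj, hc⟩ := exists_iterate_D_MFheight hwk.1 h
  have := hwk.2 j (by omega)
  rw [hc] at this
  exact not_diffble_cube x this

end CinftyWords

open CinftyWords in
/-- For every `k > 0`, `MF(C^k)` equals the set of words of `MF(C∞)` of height at most
`k`. -/
theorem mf_ck_eq_mf_cinf_height_le (k : ℕ) (hk : 0 < k) :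
    MF (CK k) = {w ∈ MF Cinf | MFheight w ≤ k} := by
  ext w
  exact ⟨mem_MF_Cinf_of_mem_MF_CK hk, fun h => mem_MF_CK_of_mem_MF_Cinf h.1 h.2⟩
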